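/- arXiv:math/0010226 — 3 statements merged into one kernel-verified Lean document; each statement's English description precedes it below -/
import Mathlib

section
/- Let A be a commutative noetherian ring of Krull dimension d with d ≤ 2n-3 and n ≥ 2. For any v, w ∈ Um_n(A) there exist ε, δ ∈ E_n(A) and elements x, y, a_2,...,a_n ∈ A such that vε = (x,a_2,...,a_n), wδ = (y,a_2,...,a_n), and x + y = 1. -/
open Matrix

/-- A row is unimodular if its entries generate the unit ideal. -/
def Unim {A : Type*} [CommRing A] {ι : Type*} (v : ι → A) : Prop :=
  Ideal.span (Set.range v) = ⊤

/-- Elementary matrices: the multiplicative closure of the set of transvections. -/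
def ElemMats (ι : Type*) (A : Type*) [Fintype ι] [DecidableEq ι] [CommRing A] :
    Submonoid (Matrix ι ι A) :=
  Submonoid.closure {M | ∃ i j c, i ≠ j ∧ M = Matrix.transvection i j c}

theorem unim_iff_forall_isPrime {A : Type*} [CommRing A] {ι : Type*} {v : ι → A} :
    Unim v ↔ ∀ P : Ideal A, P.IsPrime → ∃ i, v i ∉ P := by
  constructor
  · intro h P hP
    by_contra! hv
    exact hP.ne_top (top_le_iff.mp (h ▸ Ideal.span_le.mpr (Set.range_subset_iff.mpr hv)))
  · intro h
    by_contra hv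
    obtain ⟨M, hM, hle⟩ := Ideal.exists_le_maximal _ hv
    obtain ⟨i, hi⟩ := h M hM.isPrime
    exact hi (hle (Ideal.subset_span ⟨i, rfl⟩))

theorem Unim.exists_sum_mul_eq {A : Type*} [CommRing A] {ι : Type*} [Fintype ι] {v : ι → A}
    (h : Unim v) (a : A) : ∃ r : ι → A, ∑ i, r i * v i = a :=
  Ideal.mem_span_range_iff_exists_fun.mp (by rw [show Ideal.span (Set.range v) = ⊤ from h]; trivial)

/-- Modulo finitely many pairwise incomparable primes not containing `a`, the coset `b + aA`
contains an element avoiding all of them. -/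
theorem exists_add_mul_notMem_of_antichain {A : Type*} [CommRing A] {S : Set (Ideal A)}
    (hS : S.Finite) (hprime : ∀ P ∈ S, P.IsPrime) (hanti : IsAntichain (· ≤ ·) S)
    {a : A} (ha : ∀ P ∈ S, a ∉ P) (b : A) : ∃ c, ∀ P ∈ S, b + c * a ∉ P := by
  classical
  lift S to Finset (Ideal A) using hS
  simp only [Finset.mem_coe] at hprime ha ⊢
  obtain ⟨c, hcJ, hc⟩ : ∃ c ∈ (S.filter (b ∉ ·)).inf id, ∀ P ∈ S, b ∈ P → c ∉ P := by
    by_contra! hcon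
    have hsub : (((S.filter (b ∉ ·)).inf id : Ideal A) : Set A) ⊆
        ⋃ P ∈ (↑(S.filter (b ∈ ·)) : Set (Ideal A)), (id P : Ideal A) := by
      intro c hc
      obtain ⟨P, hP, hbP, hcP⟩ := hcon c hc
      exact Set.mem_biUnion (Finset.mem_coe.mpr (Finset.mem_filter.mpr ⟨hP, hbP⟩)) hcP
    rw [Ideal.subset_union_prime (f := id) ⊥ ⊥
      (fun P hP _ _ ↦ hprime P (Finset.mem_filter.mp hP).1)] at hsub
    obtain ⟨P, hP, hle⟩ := hsub
    obtain ⟨hPS, hbP⟩ := Finset.mem_filter.mp hP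
    obtain ⟨Q, hQ, hQP⟩ := (hprime P hPS).inf_le'.mp hle
    obtain ⟨hQS, hbQ⟩ := Finset.mem_filter.mp hQ
    exact hbQ (hanti.eq hQS hPS hQP ▸ hbP)
  refine ⟨c, fun P hP hmem ↦ ?_⟩
  by_cases hb : b ∈ P
  · exact ((hprime P hP).mem_or_mem ((P.add_mem_iff_right hb).mp hmem)).elim (hc P hP hb) (ha P hP)
  · have hcP : c ∈ P :=
      (Finset.inf_le (f := id) (Finset.mem_filter.mpr ⟨hP, hb⟩) : _ ≤ P) hcJ
    exact hb ((P.add_mem_iff_left (P.mul_mem_right a hcP)).mp hmem)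

/-- In a noetherian ring, a family `b` can be modified by multiples of `a` so that, away from the
zero locus of `a`, each member of the family raises the height by at least one. -/
theorem exists_card_le_height_of_add_mul_mem {A : Type*} [CommRing A] [IsNoetherianRing A]
    {ι : Type*} (a : A) (b : ι → A) (s : Finset ι) :
    ∃ c : ι → A, ∀ P : Ideal A, P.IsPrime → a ∉ P → (∀ i ∈ s, b i + c i * a ∈ P) →
      (s.card : ℕ∞) ≤ P.height := by
  classical
  induction s using Finset.induction_on with
  | empty => exact ⟨0, by simp⟩
  | insert k s hk ih =>
    obtain ⟨c, hc⟩ := ih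
    let I : Ideal A := Ideal.span ((fun i ↦ b i + c i * a) '' s)
    obtain ⟨e, he⟩ := exists_add_mul_notMem_of_antichain
      (S := {P | P ∈ I.minimalPrimes ∧ a ∉ P})
      ((I.finite_minimalPrimes_of_isNoetherianRing A).subset fun _ h ↦ h.1)
      (fun _ h ↦ h.1.1.1)
      (fun _ hP Q hQ hne hle ↦ hne (le_antisymm hle (hQ.1.2 hP.1.1 hle)))
      (fun _ h ↦ h.2) (b k)
    refine ⟨Function.update c k e, fun Q hQ haQ hmem ↦ ?_⟩
    have hIQ : I ≤ Q := by
      refine Ideal.span_le.mpr (Set.image_subset_iff.mpr fun i hi ↦ ?_)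
      have h := hmem i (Finset.mem_insert_of_mem hi)
      rwa [Function.update_of_ne (ne_of_mem_of_not_mem (Finset.mem_coe.mp hi) hk)] at h
    obtain ⟨P, hP, hPQ⟩ := Ideal.exists_minimalPrimes_le hIQ
    have haP : a ∉ P := fun h ↦ haQ (hPQ h)
    have hprime : P.IsPrime := hP.1.1
    have hlt : P < Q := by
      refine lt_of_le_of_ne hPQ fun h ↦ he P ⟨hP, haP⟩ ?_
      have := hmem k (Finset.mem_insert_self k s)
      rwa [Function.update_self, ← h] at this
    have hsP := hc P hprime haP fun i hi ↦ hP.1.2 (Ideal.subset_span ⟨i, hi, rfl⟩)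
    rw [Finset.card_insert_of_notMem hk, Nat.cast_add, Nat.cast_one]
    exact (by gcongr : _ ≤ P.height + 1).trans (Ideal.height_add_one_le_of_lt_of_isPrime hlt)

/-- **Bass's stable range theorem**: over a noetherian ring of Krull dimension less than `m`, every
unimodular row `(a, b₁, …, bₘ)` can be shortened. -/
theorem exists_unim_add_mul_of_ringKrullDim_lt {A : Type*} [CommRing A] [IsNoetherianRing A]
    {ι : Type*} [Fintype ι] (hd : ringKrullDim A < Fintype.card ι) (a : A) (b : ι → A)
    (h : ∀ P : Ideal A, P.IsPrime → a ∈ P → ∃ i, b i ∉ P) :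
    ∃ c : ι → A, Unim fun i ↦ b i + c i * a := by
  obtain ⟨c, hc⟩ := exists_card_le_height_of_add_mul_mem a b Finset.univ
  refine ⟨c, unim_iff_forall_isPrime.mpr fun P hP ↦ ?_⟩
  by_contra! hmem
  by_cases ha : a ∈ P
  · obtain ⟨i, hi⟩ := h P hP ha
    exact hi ((P.add_mem_iff_left (P.mul_mem_left _ ha)).mp (hmem i))
  · have hle : ((Fintype.card ι : ℕ∞) : WithBot ℕ∞) ≤ P.height :=
      WithBot.coe_le_coe.mpr (hc P hP ha fun i _ ↦ hmem i)
    exact absurd (hle.trans (Ideal.height_le_ringKrullDim_of_isPrime)) (not_le.mpr hd)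

section Elementary

variable {ι A : Type*} [Fintype ι] [DecidableEq ι] [CommRing A]

theorem transvection_mem_elemMats {i j : ι} (h : i ≠ j) (c : A) :
    Matrix.transvection i j c ∈ ElemMats ι A :=
  Submonoid.subset_closure ⟨i, j, c, h, rfl⟩

theorem vecMul_single_apply (v : ι → A) (i j k : ι) (c : A) :
    (v ᵥ* Matrix.single i j c) k = if k = j then v i * c else 0 := by
  simp [Matrix.vecMul, dotProduct, Matrix.single_apply, ite_and, eq_comm]

theorem one_add_sum_single_row_mem_elemMats {o : ι} (c : ι → A) {s : Finset ι} (ho : o ∉ s) :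
    1 + ∑ i ∈ s, Matrix.single o i (c i) ∈ ElemMats ι A := by
  induction s using Finset.induction_on with
  | empty => simp [one_mem]
  | insert k s hk ih =>
    obtain ⟨hok, hos⟩ := by simpa using ho
    have hzero : (∑ i ∈ s, Matrix.single o i (c i)) * Matrix.single o k (c k) = 0 := by
      rw [Finset.sum_mul]
      exact Finset.sum_eq_zero fun i hi ↦
        Matrix.single_mul_single_of_ne _ _ _ _ (ne_of_mem_of_not_mem hi hos) _
    have hmul := mul_mem (ih hos) (transvection_mem_elemMats hok (c k))
    rw [Matrix.transvection, mul_add, add_mul _ _ (Matrix.single _ _ _), hzero] at hmul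
    rw [Finset.sum_insert hk]
    convert hmul using 1
    simp only [mul_one, one_mul]
    abel

theorem one_add_sum_single_col_mem_elemMats {o : ι} (c : ι → A) {s : Finset ι} (ho : o ∉ s) :
    1 + ∑ i ∈ s, Matrix.single i o (c i) ∈ ElemMats ι A := by
  induction s using Finset.induction_on with
  | empty => simp [one_mem]
  | insert k s hk ih =>
    obtain ⟨hok, hos⟩ := by simpa using ho
    have hzero : (∑ i ∈ s, Matrix.single i o (c i)) * Matrix.single k o (c k) = 0 := by
      rw [Finset.sum_mul]
      exact Finset.sum_eq_zero fun i _ ↦ Matrix.single_mul_single_of_ne _ _ _ _ hok _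
    have hmul := mul_mem (ih hos) (transvection_mem_elemMats (Ne.symm hok) (c k))
    rw [Matrix.transvection, mul_add, add_mul _ _ (Matrix.single _ _ _), hzero] at hmul
    rw [Finset.sum_insert hk]
    convert hmul using 1
    simp only [mul_one, one_mul]
    abel

/-- Adding multiples of one coordinate to all the others is an elementary operation. -/
theorem exists_elemMats_add_mul_apply (o : ι) (v : ι → A) (c : {i // i ≠ o} → A) :
    ∃ ε ∈ ElemMats ι A, (v ᵥ* ε) o = v o ∧ ∀ i : {i // i ≠ o}, (v ᵥ* ε) i = v i + c i * v o := by
  let e : ι → A := fun i ↦ if h : i ≠ o then c ⟨i, h⟩ else 0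
  refine ⟨_, one_add_sum_single_row_mem_elemMats e (Finset.notMem_erase o Finset.univ), ?_, ?_⟩
  · simp only [Matrix.vecMul_add, Matrix.vecMul_one, Matrix.vecMul_sum, Pi.add_apply, Finset.sum_apply,
      vecMul_single_apply, Finset.sum_ite_eq]
    simp
  · rintro ⟨i, hi⟩
    simp only [Matrix.vecMul_add, Matrix.vecMul_one, Matrix.vecMul_sum, Pi.add_apply, Finset.sum_apply,
      vecMul_single_apply, Finset.sum_ite_eq]
    simp [e, hi, mul_comm]

/-- Adding multiples of the other coordinates to a given one is an elementary operation. -/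
theorem exists_elemMats_add_sum_mul (o : ι) (v : ι → A) (r : {i // i ≠ o} → A) :
    ∃ ε ∈ ElemMats ι A, (v ᵥ* ε) o = v o + ∑ i, r i * v i ∧
      ∀ i : {i // i ≠ o}, (v ᵥ* ε) i = v i := by
  let e : ι → A := fun i ↦ if h : i ≠ o then r ⟨i, h⟩ else 0
  refine ⟨_, one_add_sum_single_col_mem_elemMats e (Finset.notMem_erase o Finset.univ), ?_, ?_⟩
  · have hsum : ∑ i, r i * v i = ∑ i ∈ Finset.univ.erase o, v i * e i := by
      rw [Finset.sum_subtype (p := (· ≠ o)) (Finset.univ.erase o) (by simp)]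
      exact Finset.sum_congr rfl fun i _ ↦ by simp [e, i.2, mul_comm]
    simp only [Matrix.vecMul_add, Matrix.vecMul_one, Matrix.vecMul_sum, Pi.add_apply, Finset.sum_apply,
      vecMul_single_apply, hsum, if_true]
  · rintro ⟨i, hi⟩
    simp only [Matrix.vecMul_add, Matrix.vecMul_one, Matrix.vecMul_sum, Pi.add_apply, Finset.sum_apply,
      vecMul_single_apply, if_neg hi, Finset.sum_const_zero, add_zero]

end Elementary

/-- The Mennicke–Newman lemma over an arbitrary finite index type with a distinguished index. -/
theorem exists_elemMats_add_eq_one_of_ringKrullDim_lt {A : Type*} [CommRing A]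
    [IsNoetherianRing A] {ι : Type*} [Fintype ι] [DecidableEq ι] (o : ι)
    (hd : ringKrullDim A < Fintype.card ({i // i ≠ o} ⊕ {i // i ≠ o}))
    {v w : ι → A} (hv : Unim v) (hw : Unim w) :
    ∃ ε ∈ ElemMats ι A, ∃ δ ∈ ElemMats ι A,
      (v ᵥ* ε) o + (w ᵥ* δ) o = 1 ∧ ∀ i, i ≠ o → (v ᵥ* ε) i = (w ᵥ* δ) i := by
  obtain ⟨c, hc⟩ := exists_unim_add_mul_of_ringKrullDim_lt hd (v o * w o)
    (Sum.elim (fun i ↦ v i) fun i ↦ w i) <| by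
    intro P hP ho
    rcases hP.mem_or_mem ho with ho | ho
    · obtain ⟨i, hi⟩ := unim_iff_forall_isPrime.mp hv P hP
      exact ⟨.inl ⟨i, fun h ↦ hi (h ▸ ho)⟩, hi⟩
    · obtain ⟨i, hi⟩ := unim_iff_forall_isPrime.mp hw P hP
      exact ⟨.inr ⟨i, fun h ↦ hi (h ▸ ho)⟩, hi⟩
  obtain ⟨ε₁, hε₁, hv₁o, hv₁⟩ := exists_elemMats_add_mul_apply o v fun i ↦ c (.inl i) * w o
  obtain ⟨δ₁, hδ₁, hw₁o, hw₁⟩ := exists_elemMats_add_mul_apply o w fun i ↦ c (.inr i) * v o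
  obtain ⟨r, hr⟩ := hc.exists_sum_mul_eq (1 - v o - w o)
  obtain ⟨ε₂, hε₂, hv₂o, hv₂⟩ := exists_elemMats_add_sum_mul o (v ᵥ* ε₁) fun i ↦ r (.inl i)
  obtain ⟨δ₂, hδ₂, hw₂o, hw₂⟩ := exists_elemMats_add_sum_mul o (w ᵥ* δ₁) fun i ↦ r (.inr i)
  have hone : (v ᵥ* ε₁ ᵥ* ε₂) o + (w ᵥ* δ₁ ᵥ* δ₂) o = 1 := by
    have hvsum : ∑ i : {i // i ≠ o}, r (.inl i) * (v ᵥ* ε₁) i =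
        ∑ i : {i // i ≠ o}, r (.inl i) * (v i + c (.inl i) * (v o * w o)) :=
      Finset.sum_congr rfl fun i _ ↦ by rw [hv₁]; ring
    have hwsum : ∑ i : {i // i ≠ o}, r (.inr i) * (w ᵥ* δ₁) i =
        ∑ i : {i // i ≠ o}, r (.inr i) * (w i + c (.inr i) * (v o * w o)) :=
      Finset.sum_congr rfl fun i _ ↦ by rw [hw₁]; ring
    rw [Fintype.sum_sum_type] at hr
    simp only [Sum.elim_inl, Sum.elim_inr] at hr
    rw [hv₂o, hw₂o, hv₁o, hw₁o, hvsum, hwsum]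
    linear_combination hr
  obtain ⟨ε₃, hε₃, hv₃o, hv₃⟩ := exists_elemMats_add_mul_apply o (v ᵥ* ε₁ ᵥ* ε₂)
    fun i ↦ (w ᵥ* δ₁ ᵥ* δ₂) i - (v ᵥ* ε₁ ᵥ* ε₂) i
  obtain ⟨δ₃, hδ₃, hw₃o, hw₃⟩ := exists_elemMats_add_mul_apply o (w ᵥ* δ₁ ᵥ* δ₂)
    fun i ↦ (v ᵥ* ε₁ ᵥ* ε₂) i - (w ᵥ* δ₁ ᵥ* δ₂) i
  refine ⟨ε₁ * ε₂ * ε₃, mul_mem (mul_mem hε₁ hε₂) hε₃,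
    δ₁ * δ₂ * δ₃, mul_mem (mul_mem hδ₁ hδ₂) hδ₃, ?_, fun i hi ↦ ?_⟩
  · simp only [← Matrix.vecMul_vecMul]
    rw [hv₃o, hw₃o, hone]
  · simp only [← Matrix.vecMul_vecMul]
    rw [hv₃ ⟨i, hi⟩, hw₃ ⟨i, hi⟩]
    linear_combination ((w ᵥ* δ₁ ᵥ* δ₂) i - (v ᵥ* ε₁ ᵥ* ε₂) i) * hone

/-- Mennicke–Newman variant: if `A` is commutative noetherian of Krull
dimension `d ≤ 2n - 3`, `n ≥ 2`, then any two unimodular rows `v, w` of length `n` have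
elementary transforms of the form `(x, a₂, …, aₙ)` and `(y, a₂, …, aₙ)` with `x + y = 1`. -/
theorem stmt2 {A : Type*} [CommRing A] [IsNoetherianRing A] {d n : ℕ}
    (hd : ringKrullDim A ≤ d) (hn : 2 ≤ n) (hdn : d + 3 ≤ 2 * n)
    (v w : Fin n → A) (hv : Unim v) (hw : Unim w) :
    ∃ ε ∈ ElemMats (Fin n) A, ∃ δ ∈ ElemMats (Fin n) A,
      Matrix.vecMul v ε ⟨0, by omega⟩ + Matrix.vecMul w δ ⟨0, by omega⟩ = 1 ∧
      ∀ i : Fin n, i ≠ ⟨0, by omega⟩ → Matrix.vecMul v ε i = Matrix.vecMul w δ i := by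
  refine exists_elemMats_add_eq_one_of_ringKrullDim_lt _ (hd.trans_lt ?_) hv hw
  have hcard : Fintype.card {i : Fin n // i ≠ ⟨0, by omega⟩} = n - 1 := by
    simp
  rw [Fintype.card_sum, hcard]
  exact_mod_cast (by omega : d < n - 1 + (n - 1))
end

section
/- Let A be a commutative ring, n ≥ 3, and (a_1², a_2,...,a_n) ∈ Um_n(A) a unimodular row whose first entry is a square. Then there is a 2×n matrix over A with first row (a_1², a_2,...,a_n) that admits a right inverse (i.e. the row is the first row of a unimodular 2×n matrix). -/
open Matrix

/-- The `2 × 2` minors of the matrix with rows `v` and `u` generate the unit ideal. -/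
def MinorsUnim {A : Type*} [CommRing A] {ι : Type*} (v u : ι → A) : Prop :=
  ∀ I : Ideal A, (∀ i j, v i * u j - v j * u i ∈ I) → 1 ∈ I

/-- A two-rowed matrix whose `2 × 2` minors generate the unit ideal has a right inverse. -/
theorem MinorsUnim.exists_mul_eq_one {A : Type*} [CommRing A] {ι : Type*} [Fintype ι]
    [DecidableEq ι] {v u : ι → A} (h : MinorsUnim v u) :
    ∃ N : Matrix ι (Fin 2) A, of ![v, u] * N = 1 := by
  let I : Ideal A :=
    { carrier := {d | ∃ N : Matrix ι (Fin 2) A, of ![v, u] * N = d • (1 : Matrix _ _ A)}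
      add_mem' := by
        rintro x y ⟨N, hN⟩ ⟨P, hP⟩
        exact ⟨N + P, by rw [Matrix.mul_add, hN, hP, add_smul]⟩
      zero_mem' := ⟨0, by simp⟩
      smul_mem' := by
        rintro c x ⟨N, hN⟩
        exact ⟨c • N, by rw [Matrix.mul_smul, hN, smul_eq_mul, mul_smul]⟩ }
  obtain ⟨N, hN⟩ : 1 ∈ I := by
    refine h I fun i j => ⟨of fun k => ![(if k = i then u j else 0) - (if k = j then u i else 0),
      (if k = j then v i else 0) - (if k = i then v j else 0)], ?_⟩
    ext r s
    fin_cases r <;> fin_cases s <;>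
      simp [Matrix.mul_apply, mul_sub, Finset.sum_sub_distrib] <;> ring
  exact ⟨N, by rw [hN, one_smul]⟩

/-- If `m` is even, then for all `v w : Fin m → A` there is `u` such that `∑ i, v i * w i`
lies in the ideal generated by the `2 × 2` minors of the matrix with rows `v` and `u`. -/
theorem exists_dotProduct_mem_of_minors_mem {A : Type*} [CommRing A] {m : ℕ} (hm : Even m)
    (v w : Fin m → A) :
    ∃ u : Fin m → A, ∀ I : Ideal A, (∀ i j, v i * u j - v j * u i ∈ I) →
      ∑ i, v i * w i ∈ I := by
  obtain ⟨k, rfl⟩ := hm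
  let e : Fin k ⊕ Fin k ≃ Fin (k + k) := finSumFinEquiv
  refine ⟨fun i => Sum.elim (fun j => -w (e (.inr j))) (fun j => w (e (.inl j))) (e.symm i),
    fun I hI => ?_⟩
  rw [← e.sum_comp, Fintype.sum_sum_type, ← Finset.sum_add_distrib]
  refine I.sum_mem fun j _ => ?_
  simpa using hI (e (.inl j)) (e (.inr j))

/-- A unimodular row of even length is the first row of a unimodular two-rowed matrix. -/
theorem exists_minorsUnim_of_even {A : Type*} [CommRing A] {m : ℕ} (hm : Even m)
    (v w : Fin m → A) (h : ∑ i, v i * w i = 1) : ∃ u, MinorsUnim v u := by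
  obtain ⟨u, hu⟩ := exists_dotProduct_mem_of_minors_mem hm v w
  exact ⟨u, fun I hI => h ▸ hu I hI⟩

/-- A unimodular row of odd length at least three, with first entry a square, is the first row of
a unimodular two-rowed matrix. On the first three columns the second row is the one in Krusemeyer's
completion of `(a², b, c)`, whose determinant is `(a² * q + b * y + c * z)²`. -/
theorem exists_minorsUnim_sq_of_even {A : Type*} [CommRing A] {m : ℕ} (hm : Even m)
    (a b c q y z : A) (v w : Fin m → A)
    (h : a ^ 2 * q + b * y + c * z + ∑ i, v i * w i = 1) :
    ∃ u, MinorsUnim (Fin.cons (a ^ 2) (Fin.cons b (Fin.cons c v)) : Fin (m + 3) → A) u := by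
  obtain ⟨u, hu⟩ := exists_dotProduct_mem_of_minors_mem hm v w
  refine ⟨Fin.cons (-b + 2 * a * z) (Fin.cons (z ^ 2) (Fin.cons (-(a * q) - y * z) u)),
    fun I hI => ?_⟩
  have tail : ∑ i, v i * w i ∈ I :=
    hu I fun i j => by simpa using hI i.succ.succ.succ j.succ.succ.succ
  have m01 := hI 0 (Fin.succ 0)
  have m02 := hI 0 (Fin.succ (Fin.succ 0))
  have m12 := hI (Fin.succ 0) (Fin.succ (Fin.succ 0))
  simp only [Fin.cons_zero, Fin.cons_succ] at m01 m02 m12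
  have head : (a ^ 2 * q + b * y + c * z) ^ 2 ∈ I := by
    convert I.add_mem (I.add_mem (I.mul_mem_left (y ^ 2) m01)
      (I.mul_mem_left (-(a * q) + y * z) m02)) (I.mul_mem_left (-c - 2 * a * y) m12) using 1
    ring
  have split : (1 : A) = (a ^ 2 * q + b * y + c * z) ^ 2 +
      (1 + (a ^ 2 * q + b * y + c * z)) * ∑ i, v i * w i := by
    linear_combination (-(a ^ 2 * q + b * y + c * z) - 1) * h
  rw [split]
  exact I.add_mem head (I.mul_mem_left _ tail)

/-- a unimodular row of length `n ≥ 3` whose first entry is a square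
is the first row of a unimodular `2 × n` matrix (one admitting a right inverse). -/
theorem stmt3 {A : Type*} [CommRing A] {n : ℕ} (hn : 3 ≤ n + 1) (a₁ : A) (a : Fin n → A)
    (h : Unim (Fin.cons (a₁ ^ 2) a)) :
    ∃ M : Matrix (Fin 2) (Fin (n + 1)) A,
      (∃ N : Matrix (Fin (n + 1)) (Fin 2) A, M * N = 1) ∧
      M 0 = Fin.cons (a₁ ^ 2) a := by
  suffices H : ∃ u, MinorsUnim (Fin.cons (a₁ ^ 2) a : Fin (n + 1) → A) u by
    obtain ⟨u, hu⟩ := H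
    exact ⟨of ![Fin.cons (a₁ ^ 2) a, u], hu.exists_mul_eq_one, rfl⟩
  obtain ⟨w, hw⟩ : ∃ w : Fin (n + 1) → A,
      ∑ i, (Fin.cons (a₁ ^ 2) a : Fin (n + 1) → A) i * w i = 1 := by
    have h1 := (Ideal.eq_top_iff_one _).1 h
    obtain ⟨w, hw⟩ := Ideal.mem_span_range_iff_exists_fun.1 h1
    exact ⟨w, by simpa only [mul_comm] using hw⟩
  rcases Nat.even_or_odd (n + 1) with he | ho
  · exact exists_minorsUnim_of_even he _ w hw
  · obtain ⟨m, rfl⟩ : ∃ m, n = m + 2 := ⟨n - 2, by omega⟩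
    have hm : Even m := by grind
    have key := exists_minorsUnim_sq_of_even hm a₁ (a 0) (a 1) (w 0) (w 1) (w 2)
      (fun i => a i.succ.succ) (fun i => w i.succ.succ.succ) (by
        rw [← hw]
        simp only [Fin.sum_univ_succ, Fin.cons_zero, Fin.cons_succ, add_assoc]
        rfl)
    convert key using 4
    rw [← Fin.cons_self_tail a]
    congr 1
    exact (Fin.cons_self_tail (Fin.tail a)).symm
end

section
/- Let A be a commutative ring with SR-dimension d ≤ 2n-4 (e.g. noetherian of Krull dimension d), and suppose the orbit set Um_n(A)/E_n(A) carries the group structure given by the universal MS1&MS3 symbol wms. If v ∈ Um_n(A) has right inverse the transpose of (b_1,...,b_n), then the inverse of wms(v) in this group equals wms(-v_1, v_2,...,v_n) · wms(b_1², v_2,...,v_n). -/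
open Matrix

open scoped MatrixGroups

section SpecialLinear

variable {R G : Type*} [CommRing R]

/-- The matrix with rows `(a, b)` and `(c, d)` as an element of `SL₂`. -/
def slOf (a b c d : R) (h : a * d - b * c = 1) : SL(2, R) :=
  ⟨!![a, b; c, d], by rw [Matrix.det_fin_two_of, h]⟩

/-- The upper elementary matrix in `SL₂`. -/
def slUpper (t : R) : SL(2, R) := slOf 1 t 0 1 (by ring)

/-- The lower elementary matrix in `SL₂`. -/
def slLower (t : R) : SL(2, R) := slOf 1 0 t 1 (by ring)

theorem slOf_mul (a b c d a' b' c' d' : R) (h h') :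
    slOf a b c d h * slOf a' b' c' d' h' =
      slOf (a * a' + b * c') (a * b' + b * d') (c * a' + d * c') (c * b' + d * d')
        (by linear_combination (a' * d' - b' * c') * h + h') := by
  apply Subtype.ext
  rw [Matrix.SpecialLinearGroup.coe_mul]
  exact Matrix.mul_fin_two _ _ _ _ _ _ _ _

theorem slOf_congr {a b c d a' b' c' d' : R} {h h'} (ha : a = a') (hb : b = b') (hc : c = c')
    (hd : d = d') : slOf a b c d h = slOf a' b' c' d' h' := by
  subst ha hb hc hd; rfl

theorem exists_eq_slOf (M : SL(2, R)) : ∃ a b c d h, M = slOf a b c d h := by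
  refine ⟨M 0 0, M 0 1, M 1 0, M 1 1, ?_, ?_⟩
  · rw [← Matrix.det_fin_two]; exact M.2
  · ext i j
    fin_cases i <;> fin_cases j <;> simp [slOf]

theorem slOf_one : slOf (1 : R) 0 0 1 (by ring) = 1 := by
  ext i j
  fin_cases i <;> fin_cases j <;> simp [slOf]

/-- The properties of the function on `SL₂` induced by a symbol on unimodular rows. -/
structure IsRowSymbol [CommGroup G] (Φ : SL(2, R) → G) : Prop where
  upper : ∀ M N t, Φ (M * slUpper t * N) = Φ (M * N)
  lower : ∀ M N t, Φ (M * slLower t * N) = Φ (M * N)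
  row : ∀ a b c d c' d' h h', Φ (slOf a b c d h) = Φ (slOf a b c' d' h')
  one : Φ 1 = 1
  split : ∀ f m b w k h h₁ h₂, Φ (slOf (f * (1 - f * m)) b w k h) =
    Φ (slOf (1 - f * m) (f * b) (m * w) (1 + f ^ 2 * m * k) h₁ *
      slOf f b w ((1 - f * m) * k) h₂)
  mul : ∀ x y b w k h h₁ h₂, x + y = 1 → Φ (slOf (x * y) b w k h) =
    Φ (slOf x b w (y * k) h₁) * Φ (slOf y b w (x * k) h₂)

/-- `E` can be deleted from any product without changing `Φ`. -/
def Inert (Φ : SL(2, R) → G) (E : SL(2, R)) : Prop :=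
  ∀ M N, Φ (M * E * N) = Φ (M * N)

theorem Inert.mul {Φ : SL(2, R) → G} {E F : SL(2, R)} (hE : Inert Φ E) (hF : Inert Φ F) :
    Inert Φ (E * F) := fun M N => by
  rw [← mul_assoc, hF, hE]

theorem Inert.apply_mul {Φ : SL(2, R) → G} {E : SL(2, R)} (hE : Inert Φ E) (M : SL(2, R)) :
    Φ (E * M) = Φ M := by
  simpa using hE 1 M

theorem Inert.apply_mul_right {Φ : SL(2, R) → G} {E : SL(2, R)} (hE : Inert Φ E)
    (M : SL(2, R)) : Φ (M * E) = Φ M := by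
  simpa using hE M 1

theorem Inert.apply_conj_mul {Φ : SL(2, R) → G} {E₁ E₂ E₃ E₄ : SL(2, R)} (h₁ : Inert Φ E₁)
    (h₂ : Inert Φ E₂) (h₃ : Inert Φ E₃) (h₄ : Inert Φ E₄) (M N : SL(2, R)) :
    Φ ((E₁ * N * E₂) * (E₃ * M * E₄)) = Φ (N * M) := by
  have e : (E₁ * N * E₂) * (E₃ * M * E₄) = E₁ * (N * (E₂ * E₃) * M * E₄) := by
    simp only [mul_assoc]
  rw [e, h₁.apply_mul, h₄.apply_mul_right, (h₂.mul h₃)]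

namespace IsRowSymbol

variable [CommGroup G] {Φ : SL(2, R) → G}

theorem inert_upper (hΦ : IsRowSymbol Φ) (t : R) : Inert Φ (slUpper t) := fun M N => hΦ.upper M N t

theorem inert_lower (hΦ : IsRowSymbol Φ) (t : R) : Inert Φ (slLower t) := fun M N => hΦ.lower M N t

theorem inert_rot (hΦ : IsRowSymbol Φ) (e : R) : Inert Φ (slOf e 1 (-1) 0 (by ring)) := by
  have h : slOf e 1 (-1) 0 (by ring) =
      slUpper (1 - e) * slLower (-1) * slUpper 1 := by
    simp only [slUpper, slLower, slOf_mul]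
    apply slOf_congr <;> ring
  rw [h]
  exact ((hΦ.inert_upper _).mul (hΦ.inert_lower _)).mul (hΦ.inert_upper _)

/-- The two rows of a matrix have the same symbol, up to the rotation of `SL₂`. -/
theorem apply_swap (hΦ : IsRowSymbol Φ) (a b c d : R) (h h') :
    Φ (slOf a b c d h) = Φ (slOf c d (-a) (-b) h') := by
  rw [← (hΦ.inert_rot 0).apply_mul (slOf a b c d h), slOf_mul]
  congr 1
  apply slOf_congr <;> ring

theorem apply_mul_of_common_off_diagonal (hΦ : IsRowSymbol Φ) (x y b w d₁ d₂ : R) (h₁ h₂)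
    (hxy : x + y = 1) :
    Φ (slOf y b w d₂ h₂ * slOf x b w d₁ h₁) = Φ (slOf y b w d₂ h₂) * Φ (slOf x b w d₁ h₁) := by
  obtain rfl : y = 1 - x * 1 := by linear_combination hxy
  have e₁ : (1 - x * 1) * (d₁ + d₂) = d₁ := by linear_combination h₂ - h₁
  have e₂ : x * (d₁ + d₂) = d₂ := by linear_combination h₁ - h₂
  have hk : x * (1 - x * 1) * (d₁ + d₂) - b * w = 1 := by
    linear_combination h₁ + x * e₁
  have hs := hΦ.split x 1 b w (d₁ + d₂) hk (by linear_combination x * hk)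
    (by linear_combination hk)
  rw [hΦ.mul x (1 - x * 1) b w (d₁ + d₂) hk (by linear_combination hk)
    (by linear_combination hk) (by ring)] at hs
  have hM : slOf x b w ((1 - x * 1) * (d₁ + d₂)) (by linear_combination hk) =
      slOf x b w d₁ h₁ := slOf_congr rfl rfl rfl e₁
  have hN : slOf (1 - x * 1) b w (x * (d₁ + d₂)) (by linear_combination hk) =
      slOf (1 - x * 1) b w d₂ h₂ := slOf_congr rfl rfl rfl e₂
  have hN' : slOf (1 - x * 1) (x * b) (1 * w) (1 + x ^ 2 * 1 * (d₁ + d₂))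
      (by linear_combination x * hk) = slOf (1 - x * 1) b w d₂ h₂ * slUpper (-b) := by
    rw [slUpper, slOf_mul]
    apply slOf_congr
    · ring
    · ring
    · ring
    · linear_combination e₂ - hk
  rw [hM, hN, hN', hΦ.upper] at hs
  rw [← hs, mul_comm]

theorem apply_mul_of_add_eq_one (hΦ : IsRowSymbol Φ) {M N : SL(2, R)}
    (h : M 0 0 + N 0 0 = 1) : Φ (N * M) = Φ N * Φ M := by
  obtain ⟨x, b, w, d₁, h₁, rfl⟩ := exists_eq_slOf M
  obtain ⟨y, c, v, d₂, h₂, rfl⟩ := exists_eq_slOf N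
  replace h : x + y = 1 := h
  have hdM : x * (d₁ + (v - w) * b + (w + x * (v - w)) * (c - b)) -
      (b + x * (c - b)) * (w + x * (v - w)) = 1 := by linear_combination h₁
  have hdN : y * (d₂ + (w - v) * c + (v + y * (w - v)) * (b - c)) -
      (b + x * (c - b)) * (w + x * (v - w)) = 1 := by
    obtain rfl : x = 1 - y := by linear_combination h
    linear_combination h₂
  have hM : slLower (v - w) * slOf x b w d₁ h₁ * slUpper (c - b) = slOf _ _ _ _ hdM := by
    simp only [slUpper, slLower, slOf_mul]
    apply slOf_congr <;> ring
  have hN : slLower (w - v) * slOf y c v d₂ h₂ * slUpper (b - c) = slOf _ _ _ _ hdN := by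
    simp only [slUpper, slLower, slOf_mul]
    obtain rfl : x = 1 - y := by linear_combination h
    apply slOf_congr <;> ring
  have key := hΦ.apply_mul_of_common_off_diagonal _ _ _ _ _ _ hdM hdN h
  rw [← hM, ← hN, Inert.apply_conj_mul (hΦ.inert_lower _) (hΦ.inert_upper _)
    (hΦ.inert_lower _) (hΦ.inert_upper _), (hΦ.inert_upper _).apply_mul_right,
    (hΦ.inert_lower _).apply_mul, (hΦ.inert_upper _).apply_mul_right,
    (hΦ.inert_lower _).apply_mul] at key
  exact key

theorem apply_mul_of_inert (hΦ : IsRowSymbol Φ) {E₁ E₂ E₃ E₄ : SL(2, R)} (h₁ : Inert Φ E₁)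
    (h₂ : Inert Φ E₂) (h₃ : Inert Φ E₃) (h₄ : Inert Φ E₄) {M N : SL(2, R)}
    (h : (E₃ * M * E₄) 0 0 + (E₁ * N * E₂) 0 0 = 1) : Φ (N * M) = Φ N * Φ M := by
  have key := hΦ.apply_mul_of_add_eq_one h
  rwa [Inert.apply_conj_mul h₁ h₂ h₃ h₄, h₂.apply_mul_right, h₁.apply_mul, h₄.apply_mul_right,
    h₃.apply_mul] at key

/-- `Φ` is multiplicative on a pair consisting of the inverse of a matrix and the matrix. -/
theorem apply_adjugate_mul (hΦ : IsRowSymbol Φ) (a b c d : R) (h h') :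
    Φ (slOf d (-b) (-c) a h') * Φ (slOf a b c d h) = 1 := by
  rw [← hΦ.apply_mul_of_inert (hΦ.inert_rot 0)
    (hΦ.inert_lower (-(c * (d - 1)) - d * (d - 1))) (hΦ.inert_rot (c * (d - 1)))
    (hΦ.inert_lower 1), slOf_mul]
  · rw [← hΦ.one, ← slOf_one]
    congr 1
    apply slOf_congr
    · linear_combination h
    · ring
    · ring
    · linear_combination h
  · simp only [slLower, slOf_mul]
    simp only [slOf, Matrix.of_apply, Matrix.cons_val_zero]
    linear_combination -(d - 1) * h

/-- `Φ` is multiplicative on a matrix and its conjugate by `diag(1, -1)`. -/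
theorem apply_conj_diag_mul (hΦ : IsRowSymbol Φ) (a b c d : R) (h h') :
    Φ (slOf a (-b) (-c) d h' * slOf a b c d h) =
      Φ (slOf a (-b) (-c) d h') * Φ (slOf a b c d h) := by
  refine hΦ.apply_mul_of_inert (hΦ.inert_rot (-(c * (d - 1)) - d * (d - 1)))
    (hΦ.inert_lower 0) (hΦ.inert_rot (c * (d - 1))) (hΦ.inert_lower 1) ?_
  simp only [slLower, slOf_mul]
  simp only [slOf, Matrix.of_apply, Matrix.cons_val_zero]
  linear_combination -(d - 1) * h

theorem apply_square (hΦ : IsRowSymbol Φ) (f b w p : R) (h h' hs) :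
    Φ (slOf (f ^ 2) (b * (1 + f * p)) w (p ^ 2) hs) =
      Φ (slOf f (-b) (-w) p h') * Φ (slOf f b w p h) := by
  have hb : f * (1 - f * (p - 1)) * p ^ 2 - b * (1 - f * p * (p - 1)) * w = 1 := by
    linear_combination (1 - f * p * (p - 1)) * h
  have hK : slUpper (-(f * b)) * slOf (f ^ 2) (b * (1 + f * p)) w (p ^ 2) hs =
      slOf (f * (1 - f * (p - 1))) (b * (1 - f * p * (p - 1))) w (p ^ 2) hb := by
    rw [slUpper, slOf_mul]
    apply slOf_congr
    · linear_combination f * h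
    · ring
    · ring
    · ring
  have hM : slOf f b w p h * slUpper (-(b * p * (p - 1))) =
      slOf f (b * (1 - f * p * (p - 1))) w ((1 - f * (p - 1)) * p ^ 2)
        (by linear_combination hb) := by
    rw [slUpper, slOf_mul]
    apply slOf_congr
    · ring
    · ring
    · ring
    · linear_combination p * (p - 1) * h
  have hN : slOf f (-b) (-w) p h' * (slLower w * slUpper (b * (1 + f * p))) =
      slOf (1 - f * (p - 1)) (f * (b * (1 - f * p * (p - 1)))) ((p - 1) * w)
        (1 + f ^ 2 * (p - 1) * p ^ 2) (by linear_combination f * (p - 1) * hb) := by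
    simp only [slUpper, slLower, slOf_mul]
    apply slOf_congr
    · linear_combination h
    · linear_combination b * (1 + f * p) * h
    · ring
    · linear_combination -(p - 1) * (1 + f * p) * h
  rw [← (hΦ.inert_upper (-(f * b))).apply_mul, hK, hΦ.split f (p - 1) _ _ _ _
    (by linear_combination f * (p - 1) * hb) (by linear_combination hb), ← hM, ← hN, ← mul_assoc,
    (hΦ.inert_upper _).apply_mul_right, ((hΦ.inert_lower _).mul (hΦ.inert_upper _)),
    hΦ.apply_conj_diag_mul]

theorem apply_neg (hΦ : IsRowSymbol Φ) (a b c d : R) (h h') :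
    Φ (slOf a b c d h) = Φ (slOf (-a) (-b) (-c) (-d) h') := by
  rw [hΦ.apply_swap a b c d h (by linear_combination h),
    hΦ.apply_swap c d (-a) (-b) _ (by linear_combination h)]

theorem apply_swap_col (hΦ : IsRowSymbol Φ) (a b c d : R) (h h') :
    Φ (slOf a b c d h) = Φ (slOf (-b) a (-d) c h') := by
  rw [← (hΦ.inert_rot 0).apply_mul_right (slOf a b c d h), slOf_mul]
  congr 1
  apply slOf_congr <;> ring

/-- The relation between the symbols of `(f, u)`, `(-f, u)` and `(p ^ 2, u)` for
`f * p + u * q = 1`. -/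
theorem apply_mul_apply_neg_mul_apply_sq (hΦ : IsRowSymbol Φ) {f p u q c₁ d₁ c₂ d₂ c₃ d₃ : R}
    (h : f * p + u * q = 1) (h₁ h₂ h₃) :
    Φ (slOf f u c₁ d₁ h₁) * (Φ (slOf (-f) u c₂ d₂ h₂) * Φ (slOf (p ^ 2) u c₃ d₃ h₃)) = 1 := by
  have hM := hΦ.apply_adjugate_mul f q (-u) p (by linear_combination h) (by linear_combination h)
  have hN := hΦ.apply_adjugate_mul f (-q) (- -u) p (by linear_combination h)
    (by linear_combination h)
  have hsq := hΦ.apply_square f q (-u) p (by linear_combination h) (by linear_combination h)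
    (by linear_combination (f * p + 1) * h)
  rw [hΦ.apply_swap _ _ _ _ _ (by linear_combination h),
    hΦ.apply_swap_col _ _ _ _ _ (by linear_combination h)] at hM hN
  rw [hΦ.apply_neg _ _ _ _ _ (by linear_combination h)] at hN
  rw [hΦ.apply_swap _ _ _ _ _ (by linear_combination (f * p + 1) * h),
    hΦ.apply_swap_col _ _ _ _ _ (by linear_combination (f * p + 1) * h),
    hΦ.apply_neg _ _ _ _ _ (by linear_combination (f * p + 1) * h)] at hsq
  simp only [neg_neg] at hM hN hsq
  rw [hΦ.row _ _ _ _ _ _ _ h₂] at hM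
  rw [hΦ.row _ _ _ _ _ _ _ h₁] at hN
  rw [hΦ.row _ _ _ _ _ _ _ h₃] at hsq
  rw [hsq, mul_left_comm (Φ (slOf (-f) u c₂ d₂ h₂)), hM, mul_one, hN]

end IsRowSymbol
end SpecialLinear

section Rows

theorem update_vecCons_zero {α : Type*} {n : ℕ} (a x : α) (u : Fin n → α) :
    Function.update (vecCons a u) 0 x = vecCons x u := Fin.update_cons_zero (α := fun _ => α) a u x

theorem update_vecCons_succ {α : Type*} {n : ℕ} (a x : α) (u : Fin n → α) (j : Fin n) :
    Function.update (vecCons a u) j.succ x = vecCons a (Function.update u j x) :=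
  (Fin.cons_update (α := fun _ => α) a u j x).symm

variable {A : Type*} [CommRing A]

/-- Two rows are equivalent if an elementary matrix takes the first to the second. -/
def ElemEquiv {ι : Type*} [Fintype ι] [DecidableEq ι] (v w : ι → A) : Prop :=
  ∃ ε ∈ ElemMats ι A, v ᵥ* ε = w

namespace ElemEquiv

variable {ι : Type*} [Fintype ι] [DecidableEq ι] {u v w : ι → A}

theorem refl (v : ι → A) : ElemEquiv v v := ⟨1, one_mem _, Matrix.vecMul_one v⟩

theorem trans (h : ElemEquiv u v) (h' : ElemEquiv v w) : ElemEquiv u w := by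
  obtain ⟨ε, hε, rfl⟩ := h
  obtain ⟨δ, hδ, rfl⟩ := h'
  exact ⟨ε * δ, mul_mem hε hδ, by rw [Matrix.vecMul_vecMul]⟩

theorem update (v : ι → A) {i j : ι} (hij : i ≠ j) (c : A) :
    ElemEquiv v (Function.update v j (v j + c * v i)) := by
  refine ⟨Matrix.transvection i j c, Submonoid.subset_closure ⟨i, j, c, hij, rfl⟩, ?_⟩
  rw [Matrix.transvection, Matrix.vecMul_add, Matrix.vecMul_one]
  ext l
  rcases eq_or_ne l j with rfl | hl
  · simp [Matrix.vecMul, dotProduct, Matrix.single_apply, mul_comm]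
  · simp [Matrix.vecMul, dotProduct, hl, hl.symm]

theorem symm (h : ElemEquiv v w) : ElemEquiv w v := by
  obtain ⟨ε, hε, rfl⟩ := h
  induction hε using Submonoid.closure_induction generalizing v with
  | mem ε hε =>
    obtain ⟨i, j, c, hij, rfl⟩ := hε
    refine ⟨Matrix.transvection i j (-c), Submonoid.subset_closure ⟨i, j, -c, hij, rfl⟩, ?_⟩
    rw [Matrix.vecMul_vecMul, Matrix.transvection_mul_transvection_same _ _ hij, add_neg_cancel,
      Matrix.transvection_zero, Matrix.vecMul_one]
  | one => rw [Matrix.vecMul_one]; exact refl v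
  | mul ε δ _ _ h₁ h₂ => rw [← Matrix.vecMul_vecMul]; exact h₂.trans h₁

end ElemEquiv

section Moves

variable {k : ℕ}

theorem elemEquiv_second_add_mul (a b t : A) (τ : Fin (k + 1) → A) :
    ElemEquiv (vecCons a (vecCons b τ)) (vecCons a (vecCons (b + t * a) τ)) := by
  have h := ElemEquiv.update (vecCons a (vecCons b τ))
    (i := 0) (j := Fin.succ 0) (Fin.succ_ne_zero _).symm t
  rw [update_vecCons_succ, update_vecCons_zero] at h
  exact h

theorem elemEquiv_add_mul_tail (a b t : A) (τ : Fin (k + 1) → A) (j : Fin (k + 1)) :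
    ElemEquiv (vecCons a (vecCons b τ)) (vecCons (a + t * τ j) (vecCons b τ)) := by
  have h := ElemEquiv.update (vecCons a (vecCons b τ))
    (i := j.succ.succ) (j := 0) (Fin.succ_ne_zero _) t
  rw [update_vecCons_zero] at h
  exact h

theorem elemEquiv_second_add_mul_tail (a b t : A) (τ : Fin (k + 1) → A) (j : Fin (k + 1)) :
    ElemEquiv (vecCons a (vecCons b τ)) (vecCons a (vecCons (b + t * τ j) τ)) := by
  have h := ElemEquiv.update (vecCons a (vecCons b τ))
    (i := j.succ.succ) (j := Fin.succ 0) ((Fin.succ_injective _).ne (Fin.succ_ne_zero j)) t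
  rw [update_vecCons_succ, update_vecCons_zero] at h
  exact h

theorem elemEquiv_third_add_mul (a b s t : A) (σ : Fin k → A) :
    ElemEquiv (vecCons a (vecCons b (vecCons s σ)))
      (vecCons a (vecCons b (vecCons (s + t * a) σ))) := by
  have h := ElemEquiv.update (vecCons a (vecCons b (vecCons s σ)))
    (i := 0) (j := Fin.succ (Fin.succ 0)) (Fin.succ_ne_zero _).symm t
  rw [update_vecCons_succ, update_vecCons_succ, update_vecCons_zero] at h
  exact h

theorem elemEquiv_third_add_mul_second (a b s t : A) (σ : Fin k → A) :
    ElemEquiv (vecCons a (vecCons b (vecCons s σ)))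
      (vecCons a (vecCons b (vecCons (s + t * b) σ))) := by
  have h := ElemEquiv.update (vecCons a (vecCons b (vecCons s σ)))
    (i := Fin.succ 0) (j := Fin.succ (Fin.succ 0))
    ((Fin.succ_injective _).ne (Fin.succ_ne_zero 0).symm) t
  rw [update_vecCons_succ, update_vecCons_succ, update_vecCons_zero] at h
  exact h

theorem elemEquiv_add_mem_span (a b : A) {τ : Fin (k + 1) → A} {x y : A}
    (hx : x ∈ Ideal.span (Set.range τ)) (hy : y ∈ Ideal.span (Set.range τ)) :
    ElemEquiv (vecCons a (vecCons b τ)) (vecCons (a + x) (vecCons (b + y) τ)) := by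
  obtain ⟨c, rfl⟩ := (Ideal.mem_span_range_iff_exists_fun).1 hx
  obtain ⟨e, rfl⟩ := (Ideal.mem_span_range_iff_exists_fun).1 hy
  have h₁ (S : Finset (Fin (k + 1))) : ElemEquiv (vecCons a (vecCons b τ))
      (vecCons (a + ∑ i ∈ S, c i * τ i) (vecCons b τ)) := by
    induction S using Finset.induction_on with
    | empty => simpa using ElemEquiv.refl _
    | insert i S hi ih =>
      rw [Finset.sum_insert hi, add_comm (c i * τ i), ← add_assoc]
      exact ih.trans (elemEquiv_add_mul_tail _ _ _ _ _)
  have h₂ (a' : A) (S : Finset (Fin (k + 1))) : ElemEquiv (vecCons a' (vecCons b τ))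
      (vecCons a' (vecCons (b + ∑ i ∈ S, e i * τ i) τ)) := by
    induction S using Finset.induction_on with
    | empty => simpa using ElemEquiv.refl _
    | insert i S hi ih =>
      rw [Finset.sum_insert hi, add_comm (e i * τ i), ← add_assoc]
      exact ih.trans (elemEquiv_second_add_mul_tail _ _ _ _ _)
  exact (h₁ _).trans (h₂ _ _)

theorem elemEquiv_of_map_eq {R : Type*} [CommRing R] {π : A →+* R} {τ : Fin (k + 1) → A}
    (hker : RingHom.ker π ≤ Ideal.span (Set.range τ)) {a b a' b' : A} (ha : π a = π a')
    (hb : π b = π b') : ElemEquiv (vecCons a (vecCons b τ)) (vecCons a' (vecCons b' τ)) := by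
  have h := elemEquiv_add_mem_span a b (hker ((RingHom.sub_mem_ker_iff π).2 ha.symm))
    (hker ((RingHom.sub_mem_ker_iff π).2 hb.symm))
  rwa [add_sub_cancel, add_sub_cancel] at h

/-- Adding to `(a, b)` a multiple of `(c, d)` scaled by the determinant `a * d - b * c`. -/
theorem elemEquiv_add_det_mul (a b c d t : A) (τ : Fin (k + 1) → A) :
    ElemEquiv (vecCons a (vecCons b τ))
      (vecCons (a + t * (a * d - b * c) * c) (vecCons (b + t * (a * d - b * c) * d) τ)) := by
  obtain ⟨s, σ, rfl⟩ : ∃ s σ, τ = vecCons s σ := ⟨_, _, (Matrix.cons_head_tail τ).symm⟩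
  have h := elemEquiv_third_add_mul a b s d σ
  replace h := h.trans (elemEquiv_third_add_mul_second _ _ _ (-c) _)
  replace h := h.trans (elemEquiv_add_mul_tail _ _ (t * c) _ 0)
  replace h := h.trans (elemEquiv_second_add_mul_tail _ _ (t * d) _ 0)
  replace h := h.trans (elemEquiv_third_add_mul _ _ _ (-d) _)
  replace h := h.trans (elemEquiv_third_add_mul_second _ _ _ c _)
  replace h := h.trans (elemEquiv_add_mul_tail _ _ (-(t * c)) _ 0)
  replace h := h.trans (elemEquiv_second_add_mul_tail _ _ (-(t * d)) _ 0)
  simp only [Matrix.cons_val_zero] at h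
  convert h using 2
  · ring
  · congr 1
    · ring
    · congr 1
      ring

/-- The two entries are multiplied by a matrix of determinant one which becomes elementary in
size three. -/
theorem elemEquiv_mul_one_sub_mul (f m b w : A) (τ : Fin (k + 1) → A) :
    ElemEquiv (vecCons (f * (1 - f * m)) (vecCons b τ))
      (vecCons (f * (1 - f * m) * (1 + f * m * (b * w)))
        (vecCons (b * (1 + f * (1 - f * m) * m * (b * w))) τ)) := by
  obtain ⟨s, σ, rfl⟩ : ∃ s σ, τ = vecCons s σ := ⟨_, _, (Matrix.cons_head_tail τ).symm⟩
  obtain ⟨y, hy⟩ : ∃ y, y = 1 - f * m := ⟨_, rfl⟩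
  rw [← hy]
  obtain ⟨ν, hν⟩ : ∃ ν, ν = m * (b * w) ^ 2 := ⟨_, rfl⟩
  obtain ⟨θ, hθ⟩ : ∃ θ, θ = m * b * (b * w) * (1 + y * (b * w)) := ⟨_, rfl⟩
  obtain ⟨η, hη⟩ : ∃ η, η = w * f * m * (1 - y * (b * w)) := ⟨_, rfl⟩
  have h₁ := elemEquiv_add_mul_tail (f * y) b (-η) (vecCons s σ) 0
  replace h₁ := h₁.trans (elemEquiv_second_add_mul_tail _ _ ν _ 0)
  replace h₁ := h₁.trans (elemEquiv_third_add_mul_second _ _ _ (f * y) _)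
  replace h₁ := h₁.trans (elemEquiv_second_add_mul_tail _ _ (-(y * ν)) _ 0)
  replace h₁ := h₁.trans (elemEquiv_second_add_mul _ _ θ _)
  have h₂ := elemEquiv_third_add_mul_second (f * y * (1 + f * m * (b * w)))
    (b * (1 + f * y * m * (b * w))) s (f * y) σ
  replace h₂ := h₂.trans (elemEquiv_third_add_mul _ _ _ (-(b * y)) _)
  replace h₂ := h₂.trans (elemEquiv_add_mul_tail _ _ (-w) _ 0)
  replace h₂ := h₂.trans (elemEquiv_third_add_mul _ _ _ (-(f * m * b)) _)
  replace h₂ := h₂.trans (elemEquiv_add_mul_tail _ _ (w * y) _ 0)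
  replace h₂ := h₂.trans (elemEquiv_third_add_mul _ _ _ b _)
  simp only [Matrix.cons_val_zero] at h₁ h₂
  refine h₁.trans (ElemEquiv.symm ?_)
  convert h₂ using 2
  · subst hν hθ hη hy; ring
  · congr 1
    · subst hν hθ hη hy; ring
    · congr 1
      subst hν hθ hη hy; ring

end Moves
end Rows

section Symbol

variable {A R G : Type*} [CommRing A] [CommRing R] {k : ℕ} {π : A →+* R} {τ : Fin (k + 1) → A}
  {wms : (Fin (k + 3) → A) → G}

theorem unim_of_map_eq_one (hker : RingHom.ker π ≤ Ideal.span (Set.range τ)) {a b p q : A}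
    (h : π a * π p + π b * π q = 1) : Unim (vecCons a (vecCons b τ)) := by
  have hτ : Ideal.span (Set.range τ) ≤ Ideal.span (Set.range (vecCons a (vecCons b τ))) := by
    apply Ideal.span_mono
    rintro _ ⟨i, rfl⟩
    exact ⟨i.succ.succ, rfl⟩
  have ha : a ∈ Ideal.span (Set.range (vecCons a (vecCons b τ))) :=
    Ideal.subset_span ⟨0, rfl⟩
  have hb : b ∈ Ideal.span (Set.range (vecCons a (vecCons b τ))) :=
    Ideal.subset_span ⟨1, rfl⟩
  have hk : a * p + b * q - 1 ∈ Ideal.span (Set.range τ) := by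
    apply hker
    rw [RingHom.sub_mem_ker_iff, map_add, map_mul, map_mul, h, map_one]
  rw [Unim, Ideal.eq_top_iff_one]
  have := Ideal.sub_mem _ (Ideal.add_mem _ (Ideal.mul_mem_right p _ ha)
    (Ideal.mul_mem_right q _ hb)) (hτ hk)
  rwa [sub_sub_cancel] at this

/-- The function on `SL₂` which sends a matrix to the value of `wms` on a lift along `π` of its
first row, completed by `τ`. -/
noncomputable def rowSymbol (wms : (Fin (k + 3) → A) → G) (τ : Fin (k + 1) → A)
    (hπ : Function.Surjective π) (M : SL(2, R)) : G :=
  wms (vecCons (Function.surjInv hπ (M 0 0)) (vecCons (Function.surjInv hπ (M 0 1)) τ))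

theorem rowSymbol_slOf (hπ : Function.Surjective π)
    (hker : RingHom.ker π ≤ Ideal.span (Set.range τ))
    (hMS1 : ∀ v, Unim v → ∀ ε ∈ ElemMats (Fin (k + 3)) A, wms (v ᵥ* ε) = wms v)
    {x y c d : R} {h : x * d - y * c = 1} {a b a' b' : A} (ha : π a' = x) (hb : π b' = y)
    (hab : ElemEquiv (vecCons a (vecCons b τ)) (vecCons a' (vecCons b' τ))) :
    rowSymbol wms τ hπ (slOf x y c d h) = wms (vecCons a (vecCons b τ)) := by
  have hx := Function.surjInv_eq hπ x
  have hy := Function.surjInv_eq hπ y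
  have hM : rowSymbol wms τ hπ (slOf x y c d h) =
    wms (vecCons (Function.surjInv hπ x) (vecCons (Function.surjInv hπ y) τ)) := rfl
  obtain ⟨p, rfl⟩ := hπ d
  obtain ⟨q, rfl⟩ := hπ c
  have hu : Unim (vecCons (Function.surjInv hπ x) (vecCons (Function.surjInv hπ y) τ)) := by
    refine unim_of_map_eq_one hker (p := p) (q := -q) ?_
    rw [hx, hy, map_neg, ← h]
    ring
  obtain ⟨ε, hε, h⟩ :=
    (elemEquiv_of_map_eq hker (hx.trans ha.symm) (hy.trans hb.symm)).trans hab.symm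
  rw [hM, ← h, hMS1 _ hu ε hε]

theorem rowSymbol_mul_upper_mul (hπ : Function.Surjective π)
    (hker : RingHom.ker π ≤ Ideal.span (Set.range τ))
    (hMS1 : ∀ v, Unim v → ∀ ε ∈ ElemMats (Fin (k + 3)) A, wms (v ᵥ* ε) = wms v)
    (M N : SL(2, R)) (t : R) :
    rowSymbol wms τ hπ (M * slUpper t * N) = rowSymbol wms τ hπ (M * N) := by
  obtain ⟨a, b, c, d, h, rfl⟩ := exists_eq_slOf M
  obtain ⟨a', b', c', d', h', rfl⟩ := exists_eq_slOf N
  simp only [slUpper, slOf_mul]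
  obtain ⟨r, hr⟩ := hπ (a * a' + b * c')
  obtain ⟨s, hs⟩ := hπ (a * b' + b * d')
  obtain ⟨u, rfl⟩ := hπ c'
  obtain ⟨v, rfl⟩ := hπ d'
  obtain ⟨t, rfl⟩ := hπ t
  rw [rowSymbol_slOf hπ hker hMS1 _ _ (elemEquiv_add_det_mul r s u v t τ),
    rowSymbol_slOf hπ hker hMS1 hr hs (ElemEquiv.refl _)]
  · simp only [map_add, map_mul, map_sub, hr, hs]
    linear_combination π t * a * π u * h'
  · simp only [map_add, map_mul, map_sub, hr, hs]
    linear_combination π t * a * π v * h'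

theorem rowSymbol_mul_lower_mul (hπ : Function.Surjective π)
    (hker : RingHom.ker π ≤ Ideal.span (Set.range τ))
    (hMS1 : ∀ v, Unim v → ∀ ε ∈ ElemMats (Fin (k + 3)) A, wms (v ᵥ* ε) = wms v)
    (M N : SL(2, R)) (t : R) :
    rowSymbol wms τ hπ (M * slLower t * N) = rowSymbol wms τ hπ (M * N) := by
  obtain ⟨a, b, c, d, h, rfl⟩ := exists_eq_slOf M
  obtain ⟨a', b', c', d', h', rfl⟩ := exists_eq_slOf N
  simp only [slLower, slOf_mul]
  obtain ⟨r, hr⟩ := hπ (a * a' + b * c')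
  obtain ⟨s, hs⟩ := hπ (a * b' + b * d')
  obtain ⟨u, rfl⟩ := hπ a'
  obtain ⟨v, rfl⟩ := hπ b'
  obtain ⟨t, rfl⟩ := hπ t
  rw [rowSymbol_slOf hπ hker hMS1 _ _ (elemEquiv_add_det_mul r s u v (-t) τ),
    rowSymbol_slOf hπ hker hMS1 hr hs (ElemEquiv.refl _)]
  · simp only [map_add, map_mul, map_sub, map_neg, hr, hs]
    linear_combination π t * b * π u * h'
  · simp only [map_add, map_mul, map_sub, map_neg, hr, hs]
    linear_combination π t * b * π v * h'

theorem rowSymbol_split (hπ : Function.Surjective π)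
    (hker : RingHom.ker π ≤ Ideal.span (Set.range τ))
    (hMS1 : ∀ v, Unim v → ∀ ε ∈ ElemMats (Fin (k + 3)) A, wms (v ᵥ* ε) = wms v)
    (f m b w k : R) (h h₁ h₂) : rowSymbol wms τ hπ (slOf (f * (1 - f * m)) b w k h) =
      rowSymbol wms τ hπ (slOf (1 - f * m) (f * b) (m * w) (1 + f ^ 2 * m * k) h₁ *
        slOf f b w ((1 - f * m) * k) h₂) := by
  rw [← rowSymbol_mul_upper_mul hπ hker hMS1 _ _ (-(f * b)),
    ← rowSymbol_mul_lower_mul hπ hker hMS1 _ _ (-(w * m))]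
  simp only [slUpper, slLower, slOf_mul]
  obtain ⟨f, rfl⟩ := hπ f
  obtain ⟨m, rfl⟩ := hπ m
  obtain ⟨b, rfl⟩ := hπ b
  obtain ⟨w, rfl⟩ := hπ w
  rw [rowSymbol_slOf hπ hker hMS1 (h := h) (a' := f * (1 - f * m)) (by simp) rfl
    (ElemEquiv.refl _), rowSymbol_slOf hπ hker hMS1 _ _ (elemEquiv_mul_one_sub_mul f m b w τ)]
  · simp only [map_add, map_mul, map_sub, map_one]
    ring
  · simp only [map_add, map_mul, map_sub, map_one]
    linear_combination -π f * π m * π b * h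

theorem isRowSymbol_rowSymbol [CommGroup G] (hπ : Function.Surjective π)
    (hker : RingHom.ker π ≤ Ideal.span (Set.range τ))
    (hMS1 : ∀ v, Unim v → ∀ ε ∈ ElemMats (Fin (k + 3)) A, wms (v ᵥ* ε) = wms v)
    (hMS3 : ∀ (x y : A) (a : Fin (k + 2) → A), x + y = 1 → Unim (vecCons x a) →
      Unim (vecCons y a) → wms (vecCons (x * y) a) = wms (vecCons x a) * wms (vecCons y a)) :
    IsRowSymbol (rowSymbol wms τ hπ) where
  upper := rowSymbol_mul_upper_mul hπ hker hMS1
  lower := rowSymbol_mul_lower_mul hπ hker hMS1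
  row := fun _ _ _ _ _ _ _ _ => rfl
  one := by
    rw [← slOf_one, rowSymbol_slOf hπ hker hMS1 (map_one π) (map_zero π) (a := 1) (b := 1)]
    · have h₁ : Unim (vecCons 1 (vecCons 1 τ)) :=
        unim_of_map_eq_one hker (p := 1) (q := 0) (by simp)
      have h₂ : Unim (vecCons 0 (vecCons 1 τ)) :=
        unim_of_map_eq_one hker (p := 0) (q := 1) (by simp)
      simpa using hMS3 1 0 (vecCons 1 τ) (by simp) h₁ h₂
    · simpa using elemEquiv_second_add_mul 1 1 (-1) τ
  split := rowSymbol_split hπ hker hMS1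
  mul := by
    intro x y b w k h h₁ h₂ hxy
    obtain rfl : y = 1 - x := by linear_combination hxy
    obtain ⟨x, rfl⟩ := hπ x
    obtain ⟨b, rfl⟩ := hπ b
    obtain ⟨w, rfl⟩ := hπ w
    obtain ⟨k, rfl⟩ := hπ k
    have hux : Unim (vecCons x (vecCons b τ)) := by
      refine unim_of_map_eq_one hker (p := (1 - x) * k) (q := -w) ?_
      simp only [map_mul, map_sub, map_one, map_neg]
      linear_combination h
    have huy : Unim (vecCons (1 - x) (vecCons b τ)) := by
      refine unim_of_map_eq_one hker (p := x * k) (q := -w) ?_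
      simp only [map_mul, map_sub, map_one, map_neg]
      linear_combination h
    rw [rowSymbol_slOf hπ hker hMS1 (a' := x * (1 - x)) (by simp) rfl (ElemEquiv.refl _),
      rowSymbol_slOf hπ hker hMS1 rfl rfl (ElemEquiv.refl _),
      rowSymbol_slOf hπ hker hMS1 (a' := 1 - x) (by simp) rfl (ElemEquiv.refl _)]
    exact hMS3 x (1 - x) _ (by ring) hux huy

end Symbol

/-- for a ring of dimension `d ≤ 2n - 4` and a symbol `wms` on
unimodular rows of length `n` with values in an abelian group satisfying MS1 and MS3
(in particular the universal such symbol, which gives the group structure on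
`Um_n(A)/E_n(A)`): if `v` has right inverse the transpose of `(b₁, …, bₙ)`, then
`wms(v)⁻¹ = wms(-v₁, v₂, …, vₙ) · wms(b₁², v₂, …, vₙ)`. -/
theorem stmt9 {A G : Type*} [CommRing A] [IsNoetherianRing A] [CommGroup G] {d n : ℕ}
    (hd : ringKrullDim A ≤ d) (hd2 : 2 ≤ d) (hdn : d + 4 ≤ 2 * (n + 1))
    (wms : (Fin (n + 1) → A) → G)
    (hMS1 : ∀ v : Fin (n + 1) → A, Unim v → ∀ ε ∈ ElemMats (Fin (n + 1)) A,
      wms (Matrix.vecMul v ε) = wms v)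
    (hMS3 : ∀ (x y : A) (a : Fin n → A), x + y = 1 →
      Unim (Fin.cons x a) → Unim (Fin.cons y a) →
      wms (Fin.cons (x * y) a) = wms (Fin.cons x a) * wms (Fin.cons y a))
    (v b : Fin (n + 1) → A) (hvb : ∑ i, v i * b i = 1) :
    (wms v)⁻¹ =
      wms (Function.update v 0 (-(v 0))) * wms (Function.update v 0 (b 0 ^ 2)) := by
  obtain ⟨k, rfl⟩ : ∃ k, n = k + 2 := ⟨n - 2, by omega⟩
  obtain ⟨f, u, τ, rfl⟩ : ∃ f u τ, v = vecCons f (vecCons u τ) :=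
    ⟨_, _, _, by rw [Matrix.cons_head_tail, Matrix.cons_head_tail]⟩
  rw [update_vecCons_zero, update_vecCons_zero, inv_eq_iff_mul_eq_one, Matrix.cons_val_zero]
  obtain ⟨π, hπ⟩ : ∃ π, π = Ideal.Quotient.mk (Ideal.span (Set.range τ)) := ⟨_, rfl⟩
  have hsurj : Function.Surjective π := hπ ▸ Ideal.Quotient.mk_surjective
  have hker : RingHom.ker π = Ideal.span (Set.range τ) := hπ ▸ Ideal.mk_ker
  have h : π f * π (b 0) + π u * π (b 1) = 1 := by
    have hτ : ∑ i, τ i * b i.succ.succ ∈ RingHom.ker π := by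
      rw [hker]
      exact Ideal.sum_mem _ fun i _ => Ideal.mul_mem_right _ _ (Ideal.subset_span ⟨i, rfl⟩)
    have hsum := congrArg π hvb
    rw [Fin.sum_univ_succ, Fin.sum_univ_succ, map_add, map_add, map_mul, map_mul, map_one] at hsum
    rw [RingHom.mem_ker] at hτ
    simp only [Matrix.cons_val_zero, Matrix.cons_val_succ] at hsum
    rwa [hτ, add_zero] at hsum
  have key := (isRowSymbol_rowSymbol hsurj hker.le hMS1 hMS3).apply_mul_apply_neg_mul_apply_sq h
    (c₁ := -π (b 1)) (d₁ := π (b 0)) (c₂ := -π (b 1)) (d₂ := -π (b 0))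
    (c₃ := -(π (b 1) * (1 + π f * π (b 0)))) (d₃ := π f ^ 2) (by linear_combination h)
    (by linear_combination h) (by linear_combination (π f * π (b 0) + 1) * h)
  rwa [rowSymbol_slOf hsurj hker.le hMS1 rfl rfl (ElemEquiv.refl _),
    rowSymbol_slOf hsurj hker.le hMS1 (map_neg π f) rfl (ElemEquiv.refl _),
    rowSymbol_slOf hsurj hker.le hMS1 (map_pow π (b 0) 2) rfl (ElemEquiv.refl _)] at key
end
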